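/- Let G be a Θ1-graph of order n ≥ 12. Then Sz*(G) < (n³ + 2n² − 18)/4. -/

import Mathlib

attribute [local instance] Classical.propDecidable

noncomputable def nC {V : Type*} [Fintype V] (G : SimpleGraph V) (u v : V) : ℕ :=
  (Finset.univ.filter fun w => G.dist u w < G.dist v w).card

noncomputable def nE {V : Type*} [Fintype V] (G : SimpleGraph V) (u v : V) : ℕ :=
  (Finset.univ.filter fun w => G.dist u w = G.dist v w).card

lemma nE_comm {V : Type*} [Fintype V] (G : SimpleGraph V) (u v : V) :
    nE G u v = nE G v u := by
  unfold nE; congr 1; ext w; simp [eq_comm]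

noncomputable def szContrib {V : Type*} [Fintype V] (G : SimpleGraph V) : Sym2 V → ℚ :=
  Sym2.lift ⟨fun u v =>
    ((nC G u v : ℚ) + (nE G u v : ℚ) / 2) * ((nC G v u : ℚ) + (nE G u v : ℚ) / 2),
    fun u v => by dsimp only; rw [nE_comm]; ring⟩

noncomputable def revSz {V : Type*} [Fintype V] (G : SimpleGraph V) : ℚ :=
  ∑ e ∈ G.edgeFinset, szContrib G e
/-- Two paths are internally disjoint if every common vertex is an endpoint of both. -/
def IntDisj {V : Type*} {G : SimpleGraph V} {x y x' y' : V}
    (P : G.Walk x y) (Q : G.Walk x' y') : Prop :=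
  ∀ v : V, v ∈ P.support → v ∈ Q.support → (v = x ∨ v = y) ∧ (v = x' ∨ v = y')
/-- `G` consists of the two distinct vertices `x, y` joined by the four pairwise
internally disjoint paths `P₁, P₂, P₃, P₄`, every vertex and every edge of `G`
lying on one of these paths. -/
def Theta1Cond {V : Type*} (G : SimpleGraph V) (x y : V)
    (P₁ P₂ P₃ P₄ : G.Walk x y) : Prop :=
  x ≠ y ∧
  P₁.IsPath ∧ P₂.IsPath ∧ P₃.IsPath ∧ P₄.IsPath ∧
  1 ≤ P₁.length ∧ 1 ≤ P₂.length ∧ 1 ≤ P₃.length ∧ 1 ≤ P₄.length ∧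
  P₁ ≠ P₂ ∧ P₁ ≠ P₃ ∧ P₁ ≠ P₄ ∧ P₂ ≠ P₃ ∧ P₂ ≠ P₄ ∧ P₃ ≠ P₄ ∧
  IntDisj P₁ P₂ ∧ IntDisj P₁ P₃ ∧ IntDisj P₁ P₄ ∧
  IntDisj P₂ P₃ ∧ IntDisj P₂ P₄ ∧ IntDisj P₃ P₄ ∧
  (∀ v : V, v ∈ P₁.support ∨ v ∈ P₂.support ∨ v ∈ P₃.support ∨ v ∈ P₄.support) ∧
  (∀ e ∈ G.edgeSet, e ∈ P₁.edges ∨ e ∈ P₂.edges ∨ e ∈ P₃.edges ∨ e ∈ P₄.edges)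

/-- `G` is a Θ₁-graph. -/
def IsTheta1 {V : Type*} (G : SimpleGraph V) : Prop :=
  ∃ (x y : V) (P₁ P₂ P₃ P₄ : G.Walk x y), Theta1Cond G x y P₁ P₂ P₃ P₄

section Arithmetic

lemma sum_Ico_one_sub_eq (c : ℕ → ℤ) {n : ℕ} (hn : 1 ≤ n) :
    ∑ j ∈ Finset.Ico 1 n, (c (j + 1) - c j) = c n - c 1 := by
  induction n, hn using Nat.le_induction with
  | base => simp
  | succ n hn ih => rw [Finset.sum_Ico_succ_top hn, ih]; ring

/-- The first term is the distance to position `j` on a path of length `q`, through either end,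
from a point at distance `1` and `min (1 + s) (l - 1)` from the two ends; the second one is that
from a point at distance `0` and `min s l`. -/
lemma one_le_sum_far {l s q : ℕ} (hl : 2 ≤ l) (hs : 1 ≤ s) (hsq : s ≤ q) (hq : 2 ≤ q) :
    (1 : ℤ) ≤ ∑ j ∈ Finset.Ico 1 q,
      (min (1 + j : ℤ) (min (1 + s : ℤ) (l - 1) + q - j) - min (j : ℤ) (min (s : ℤ) l + q - j)) := by
  by_cases h : l ≤ s
  · have := sum_Ico_one_sub_eq (fun j => min (j : ℤ) (l + q - j)) (n := q) (by omega)
    rw [Finset.sum_congr rfl (g := fun j : ℕ =>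
      min ((j + 1 : ℕ) : ℤ) (l + q - (j + 1 : ℕ)) - min (j : ℤ) (l + q - j))
      (fun j hj => by push_cast; omega), this]
    push_cast
    omega
  · refine le_trans ?_ (Finset.single_le_sum (fun j hj => ?_)
      (Finset.mem_Ico.2 ⟨le_refl 1, by omega⟩))
    · push_cast; omega
    · omega

lemma sum_opposite {l s : ℕ} (hl : 2 ≤ l) (hs : 1 ≤ s) :
    ∑ j ∈ Finset.Ico 1 s,
      (min (1 + j : ℤ) (min (1 + s : ℤ) (l - 1) + s - j) - min (j : ℤ) (min (s : ℤ) l + s - j))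
      = min (s : ℤ) l - 1 := by
  have := sum_Ico_one_sub_eq (fun j => min (j : ℤ) (l + s - j)) hs
  rw [Finset.sum_congr rfl (g := fun j : ℕ =>
      min ((j + 1 : ℕ) : ℤ) (l + s - (j + 1 : ℕ)) - min (j : ℤ) (l + s - j))
      (fun j hj => by have := Finset.mem_Ico.1 hj; push_cast; omega), this]
  push_cast
  omega

lemma sum_near {l s : ℕ} (hl : 2 ≤ l) (hs : 1 ≤ s) :
    ∑ j ∈ Finset.Ico 1 l,
      (min |(j : ℤ) - 1| (l + s + 1 - j) - min (j : ℤ) (min (s : ℤ) l + l - j))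
      = - min (1 + s : ℤ) (l - 1) := by
  have := sum_Ico_one_sub_eq (fun j => - min ((j : ℤ) - 1) (l + s + 1 - j)) (n := l) (by omega)
  rw [Finset.sum_congr rfl (g := fun j : ℕ =>
      - min (((j + 1 : ℕ) : ℤ) - 1) (l + s + 1 - (j + 1 : ℕ)) - - min ((j : ℤ) - 1) (l + s + 1 - j))
      (fun j hj => by
        have := Finset.mem_Ico.1 hj
        rw [abs_of_nonneg (by omega)]; push_cast; omega), this]
  push_cast
  omega

end Arithmetic

section Distance

variable {V : Type*} {G : SimpleGraph V}

lemma sub_le_length_of_lipschitz {f : V → ℤ} (hf : ∀ a b, G.Adj a b → f b ≤ f a + 1)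
    {u v : V} (p : G.Walk u v) : f v - f u ≤ p.length := by
  induction p with
  | nil => simp
  | cons h p ih => have := hf _ _ h; push_cast [SimpleGraph.Walk.length_cons]; linarith

lemma sub_le_dist_of_lipschitz (hG : G.Connected) {f : V → ℤ}
    (hf : ∀ a b, G.Adj a b → f b ≤ f a + 1) (u v : V) : f v - f u ≤ G.dist u v := by
  obtain ⟨p, hp⟩ := hG.exists_walk_length_eq_dist u v
  rw [← hp]
  exact sub_le_length_of_lipschitz hf p

lemma dist_start_getVert_le {x y : V} (p : G.Walk x y) {j : ℕ} (hj : j ≤ p.length) :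
    G.dist x (p.getVert j) ≤ j := by
  have := SimpleGraph.dist_le (p.take j)
  rwa [SimpleGraph.Walk.take_length, min_eq_left hj] at this

lemma dist_end_getVert_le {x y : V} (p : G.Walk x y) (j : ℕ) :
    G.dist y (p.getVert j) ≤ p.length - j := by
  have := SimpleGraph.dist_le (p.drop j)
  rwa [SimpleGraph.Walk.drop_length, SimpleGraph.dist_comm] at this

variable [Fintype V]

/-- The transmission of `v`: the sum of the distances from `v` to all vertices. -/
noncomputable def transmission (G : SimpleGraph V) (v : V) : ℤ :=
  ∑ w, (G.dist v w : ℤ)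

lemma nC_sub_nC (hG : G.Connected) {u v : V} (h : G.Adj u v) :
    (nC G u v : ℤ) - nC G v u = transmission G v - transmission G u := by
  simp only [nC, transmission, Finset.card_filter, Nat.cast_sum]
  rw [← Finset.sum_sub_distrib, ← Finset.sum_sub_distrib]
  refine Finset.sum_congr rfl fun w _ => ?_
  have h₁ := hG.dist_triangle (u := u) (v := v) (w := w)
  have h₂ := hG.dist_triangle (u := v) (v := u) (w := w)
  rw [SimpleGraph.dist_eq_one_iff_adj.2 h] at h₁
  rw [SimpleGraph.dist_eq_one_iff_adj.2 h.symm] at h₂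
  split_ifs <;> push_cast <;> omega

lemma nC_add_nC_add_nE (G : SimpleGraph V) (u v : V) :
    nC G u v + nC G v u + nE G u v = Fintype.card V := by
  simp only [nC, nE, Finset.card_filter]
  rw [← Finset.sum_add_distrib, ← Finset.sum_add_distrib, Fintype.card, Finset.card_eq_sum_ones]
  refine Finset.sum_congr rfl fun w _ => ?_
  split_ifs <;> omega

/-- The squared difference of the transmissions of the two ends of an edge. -/
noncomputable def sqDiff (G : SimpleGraph V) : Sym2 V → ℤ :=
  Sym2.lift ⟨fun u v => (transmission G v - transmission G u) ^ 2, fun u v => by ring⟩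

lemma sqDiff_nonneg (e : Sym2 V) : 0 ≤ sqDiff G e := by
  induction e with
  | _ u v => exact sq_nonneg _

lemma szContrib_eq (hG : G.Connected) {e : Sym2 V} (he : e ∈ G.edgeSet) :
    szContrib G e = ((Fintype.card V : ℚ) ^ 2 - sqDiff G e) / 4 := by
  induction e with
  | _ u v =>
    have h₁ : (nC G u v : ℚ) - nC G v u = transmission G v - transmission G u :=
      mod_cast nC_sub_nC hG he
    have h₂ : (nC G u v : ℚ) + nC G v u + nE G u v = Fintype.card V :=
      mod_cast nC_add_nC_add_nE G u v
    simp only [szContrib, sqDiff, Sym2.lift_mk]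
    push_cast
    rw [← h₁, ← h₂]
    ring

lemma revSz_eq (hG : G.Connected) :
    revSz G = (G.edgeFinset.card * (Fintype.card V : ℚ) ^ 2
      - (∑ e ∈ G.edgeFinset, sqDiff G e : ℤ)) / 4 := by
  rw [revSz, Finset.sum_congr rfl fun e he =>
    szContrib_eq hG (SimpleGraph.mem_edgeFinset.1 he), ← Finset.sum_div,
    Finset.sum_sub_distrib, Finset.sum_const, nsmul_eq_mul]
  push_cast
  rfl

end Distance

/-- The walks `P i` are distinct internally disjoint paths between two distinct vertices, and
every vertex and edge of `G` lies on one of them. -/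
structure IsThetaFamily {V ι : Type*} {G : SimpleGraph V} {x y : V} (P : ι → G.Walk x y) :
    Prop where
  ne : x ≠ y
  isPath : ∀ i, (P i).IsPath
  injective : Function.Injective P
  intDisj : ∀ i j, i ≠ j → IntDisj (P i) (P j)
  exists_mem_support : ∀ v, ∃ i, v ∈ (P i).support
  exists_mem_edges : ∀ e ∈ G.edgeSet, ∃ i, e ∈ (P i).edges

namespace IsThetaFamily

variable {V ι : Type*} {G : SimpleGraph V} {x y : V} {P : ι → G.Walk x y}

lemma reverse (h : IsThetaFamily P) : IsThetaFamily fun i => (P i).reverse where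
  ne := h.ne.symm
  isPath i := (h.isPath i).reverse
  injective i j hij := h.injective (SimpleGraph.Walk.reverse_injective hij)
  intDisj i j hij v hi hj := by
    have := h.intDisj i j hij v (by simpa using hi) (by simpa using hj)
    tauto
  exists_mem_support v := by simpa using h.exists_mem_support v
  exists_mem_edges e he := by simpa using h.exists_mem_edges e he

lemma one_le_length (h : IsThetaFamily P) (i : ι) : 1 ≤ (P i).length := by
  by_contra hi
  exact h.ne (SimpleGraph.Walk.eq_of_length_eq_zero (p := P i) (by omega))

lemma connected (h : IsThetaFamily P) : G.Connected := by
  have hx : ∀ v, G.Reachable x v := fun v => by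
    obtain ⟨i, hi⟩ := h.exists_mem_support v
    exact ⟨(P i).takeUntil v hi⟩
  have : Nonempty V := ⟨x⟩
  exact ⟨fun u v => (hx u).symm.trans (hx v)⟩

lemma exists_getVert (h : IsThetaFamily P) (v : V) :
    ∃ i j, j ≤ (P i).length ∧ (P i).getVert j = v := by
  obtain ⟨i, hi⟩ := h.exists_mem_support v
  obtain ⟨j, hj, hl⟩ := SimpleGraph.Walk.mem_support_iff_exists_getVert.1 hi
  exact ⟨i, j, hl, hj⟩

lemma getVert_eq_start_iff (h : IsThetaFamily P) {i : ι} {j : ℕ} (hj : j ≤ (P i).length) :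
    (P i).getVert j = x ↔ j = 0 :=
  (h.isPath i).getVert_eq_start_iff hj

lemma getVert_eq_end_iff (h : IsThetaFamily P) {i : ι} {j : ℕ} (hj : j ≤ (P i).length) :
    (P i).getVert j = y ↔ j = (P i).length :=
  (h.isPath i).getVert_eq_end_iff hj

lemma getVert_eq_getVert (h : IsThetaFamily P) {i i' : ι} {j j' : ℕ} (hj : j ≤ (P i).length)
    (hj' : j' ≤ (P i').length) (he : (P i).getVert j = (P i').getVert j') :
    (i = i' ∧ j = j') ∨ (j = 0 ∧ j' = 0) ∨ (j = (P i).length ∧ j' = (P i').length) := by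
  by_cases hi : i = i'
  · subst hi
    exact Or.inl ⟨rfl, (h.isPath i).getVert_injOn hj hj' he⟩
  · right
    have := h.intDisj i i' hi _ ((P i).getVert_mem_support j)
      (he ▸ (P i').getVert_mem_support j')
    rcases this.1 with hx | hy
    · exact Or.inl ⟨(h.getVert_eq_start_iff hj).1 hx, (h.getVert_eq_start_iff hj').1 (he ▸ hx)⟩
    · exact Or.inr ⟨(h.getVert_eq_end_iff hj).1 hy, (h.getVert_eq_end_iff hj').1 (he ▸ hy)⟩

/-- A function on `V` may be prescribed along each path, with common values at the ends. -/
lemma exists_extension (h : IsThetaFamily P) (F : ι → ℕ → ℤ) (A B : ℤ) (hA : ∀ i, F i 0 = A)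
    (hB : ∀ i, F i (P i).length = B) :
    ∃ f : V → ℤ, ∀ i j, j ≤ (P i).length → f ((P i).getVert j) = F i j := by
  choose a b hb hab using h.exists_getVert
  refine ⟨fun v => F (a v) (b v), fun i j hj => ?_⟩
  rcases h.getVert_eq_getVert (hb _) hj (hab ((P i).getVert j)) with ⟨h₁, h₂⟩ | ⟨h₁, h₂⟩ | ⟨h₁, h₂⟩
  · simp only [h₁, h₂]
  · change F _ (b _) = _
    rw [h₁, h₂, hA, hA]
  · change F _ (b _) = _
    rw [h₁, h₂, hB, hB]

lemma exists_edge_eq (h : IsThetaFamily P) {a b : V} (hab : G.Adj a b) :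
    ∃ i, ∃ j < (P i).length, s((P i).getVert j, (P i).getVert (j + 1)) = s(a, b) := by
  obtain ⟨i, hi⟩ := h.exists_mem_edges s(a, b) hab
  obtain ⟨j, hj⟩ := (P i).mk_mem_edges_iff_exists.1 hi
  exact ⟨i, j, hj⟩

lemma lipschitz_of_paths (h : IsThetaFamily P) {f : V → ℤ}
    (hf : ∀ i, ∀ j < (P i).length, |f ((P i).getVert (j + 1)) - f ((P i).getVert j)| ≤ 1)
    (a b : V) (hab : G.Adj a b) : f b ≤ f a + 1 := by
  obtain ⟨i, j, hj, he⟩ := h.exists_edge_eq hab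
  have := abs_le.1 (hf i j hj)
  rcases Sym2.eq_iff.1 he with ⟨h₁, h₂⟩ | ⟨h₁, h₂⟩ <;> rw [h₁, h₂] at this <;> omega

lemma sum_eq [Fintype V] [Fintype ι] [Nonempty ι] (h : IsThetaFamily P) (f : V → ℤ) :
    ∑ v, f v = f x + f y + ∑ i, ∑ j ∈ Finset.Ico 1 (P i).length, f ((P i).getVert j) := by
  have hinj : Set.InjOn (fun p : (_ : ι) × ℕ => (P p.1).getVert p.2)
      (Finset.univ.sigma fun i => Finset.Ico 1 (P i).length : Finset ((_ : ι) × ℕ)) := by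
    rintro ⟨i, j⟩ hp ⟨i', j'⟩ hp' he
    simp only [Finset.coe_sigma, Set.mem_sigma_iff, Finset.mem_coe, Finset.mem_univ,
      Finset.mem_Ico, true_and] at hp hp'
    rcases h.getVert_eq_getVert hp.2.le hp'.2.le he with ⟨rfl, rfl⟩ | h' | h'
    · rfl
    · omega
    · omega
  have huniv : (Finset.univ : Finset V) = insert x (insert y
      ((Finset.univ.sigma fun i => Finset.Ico 1 (P i).length).image
        fun p : (_ : ι) × ℕ => (P p.1).getVert p.2)) := by
    refine (Finset.eq_univ_of_forall fun v => ?_).symm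
    obtain ⟨i, j, hj, rfl⟩ := h.exists_getVert v
    simp only [Finset.mem_insert, h.getVert_eq_start_iff hj, h.getVert_eq_end_iff hj]
    by_cases h₀ : j = 0
    · exact Or.inl h₀
    by_cases h₁ : j = (P i).length
    · exact Or.inr (Or.inl h₁)
    refine Or.inr (Or.inr (Finset.mem_image.2 ⟨⟨i, j⟩, ?_, rfl⟩))
    simp only [Finset.mem_sigma, Finset.mem_univ, Finset.mem_Ico, true_and]
    omega
  rw [huniv, Finset.sum_insert, Finset.sum_insert, Finset.sum_image hinj, Finset.sum_sigma,
    add_assoc]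
  · intro hy
    obtain ⟨⟨i, j⟩, hp, he⟩ := Finset.mem_image.1 hy
    simp only [Finset.mem_sigma, Finset.mem_univ, Finset.mem_Ico, true_and] at hp
    exact hp.2.ne ((h.getVert_eq_end_iff hp.2.le).1 he)
  · intro hx
    rcases Finset.mem_insert.1 hx with hx | hx
    · exact h.ne hx
    obtain ⟨⟨i, j⟩, hp, he⟩ := Finset.mem_image.1 hx
    simp only [Finset.mem_sigma, Finset.mem_univ, Finset.mem_Ico, true_and] at hp
    have := (h.getVert_eq_start_iff hp.2.le).1 he
    omega

lemma card_edgeFinset_le [Fintype V] [Fintype ι] (h : IsThetaFamily P) :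
    G.edgeFinset.card ≤ ∑ i, (P i).length := by
  have hsub : G.edgeFinset ⊆ Finset.univ.biUnion fun i => (P i).edges.toFinset := fun e he => by
    simpa using h.exists_mem_edges e (SimpleGraph.mem_edgeFinset.1 he)
  refine (Finset.card_le_card hsub).trans (Finset.card_biUnion_le.trans
    (Finset.sum_le_sum fun i _ => ?_))
  exact (List.toFinset_card_le _).trans (SimpleGraph.Walk.length_edges _).le

lemma card_edgeFinset_add_two_le [Fintype V] [Fintype ι] [Nonempty ι] (h : IsThetaFamily P) :
    G.edgeFinset.card + 2 ≤ Fintype.card V + Fintype.card ι := by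
  have h₁ := h.card_edgeFinset_le
  have h₂ := h.sum_eq fun _ => 1
  have h₃ : ∑ i, (((P i).length : ℤ) - 1) =
      ∑ i, ∑ j ∈ Finset.Ico 1 (P i).length, (1 : ℤ) := by
    refine Finset.sum_congr rfl fun i _ => ?_
    have := h.one_le_length i
    simp only [Finset.sum_const, Nat.card_Ico, mul_one, nsmul_eq_mul]
    omega
  rw [← h₃, Finset.sum_sub_distrib] at h₂
  simp only [Finset.sum_const, Finset.card_univ, nsmul_eq_mul, mul_one] at h₂
  have h₄ : ((∑ i, (P i).length : ℕ) : ℤ) = ∑ i, ((P i).length : ℤ) := by push_cast; rfl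
  omega

/-- At most one of the paths is a single edge. -/
lemma eq_of_length_eq_one (h : IsThetaFamily P) {i j : ι} (hi : (P i).length = 1)
    (hj : (P j).length = 1) : i = j := by
  refine h.injective (SimpleGraph.Walk.ext_getVert_le_length (by omega) fun k hk => ?_)
  have hyi := (P i).getVert_length
  have hyj := (P j).getVert_length
  rw [hi] at hyi
  rw [hj] at hyj
  obtain rfl | rfl : k = 0 ∨ k = 1 := by omega
  · simp
  · rw [hyi, hyj]

/-- An upper bound for the distances from `x`, through either end of a path. -/
lemma dist_start_le (h : IsThetaFamily P) (i k i' : ι) {j : ℕ} (hj : j ≤ (P i').length) :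
    (G.dist x ((P i').getVert j) : ℤ) ≤
      min (j : ℤ) (min ((P k).length : ℤ) (P i).length + (P i').length - j) := by
  have h₁ := dist_start_getVert_le (P i') hj
  have h₂ := dist_end_getVert_le (P i') j
  have h₃ := SimpleGraph.dist_le (P i)
  have h₄ := SimpleGraph.dist_le (P k)
  have h₅ := h.connected.dist_triangle (u := x) (v := y) (w := (P i').getVert j)
  omega

/-- Lower bounds for the distances from the second vertex of `P i`, where `P k` is shortest
among the other paths. -/
lemma le_dist_snd (h : IsThetaFamily P) {i k : ι} (hi : 2 ≤ (P i).length)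
    (hk : k ≠ i) (hmin : ∀ i', i' ≠ i → (P k).length ≤ (P i').length) :
    (∀ j ≤ (P i).length, min |(j : ℤ) - 1| ((P i).length + (P k).length + 1 - j) ≤
        G.dist ((P i).getVert 1) ((P i).getVert j)) ∧
    ∀ i' ≠ i, ∀ j ≤ (P i').length,
      min (1 + j : ℤ) (min (1 + (P k).length : ℤ) ((P i).length - 1) + (P i').length - j) ≤
        G.dist ((P i).getVert 1) ((P i').getVert j) := by
  obtain ⟨f, hf⟩ := h.exists_extension
    (fun i' j => if i' = i then min |(j : ℤ) - 1| ((P i).length + (P k).length + 1 - j)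
      else min (1 + j : ℤ) (min (1 + (P k).length : ℤ) ((P i).length - 1) + (P i').length - j))
    1 (min (1 + (P k).length : ℤ) ((P i).length - 1))
    (fun i' => by
      have := h.one_le_length i'
      have := h.one_le_length k
      split_ifs
      · norm_num; omega
      · push_cast; omega)
    (fun i' => by
      split_ifs with hi'
      · subst hi'
        rw [abs_of_nonneg (by omega)]
        omega
      · have := hmin i' hi'
        omega)
  have hlip := h.lipschitz_of_paths (f := f) fun i' j hj => by
    rw [hf _ _ hj, hf _ _ hj.le]
    split_ifs <;> grind
  have h₀ : f ((P i).getVert 1) = 0 := by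
    rw [hf _ _ (by omega), if_pos rfl]
    push_cast
    norm_num
    omega
  have hlow := sub_le_dist_of_lipschitz h.connected hlip ((P i).getVert 1)
  refine ⟨fun j hj => ?_, fun i' hi' j hj => ?_⟩
  · have := hlow ((P i).getVert j)
    rwa [h₀, hf _ _ hj, if_pos rfl, sub_zero] at this
  · have := hlow ((P i').getVert j)
    rwa [h₀, hf _ _ hj, if_neg hi', sub_zero] at this

variable [Fintype V] [Fintype ι]

/-- The transmission grows by at least the number of paths minus two along the first edge of
each path of length at least two. -/
lemma card_le_transmission_sub (h : IsThetaFamily P) (hι : 2 ≤ Fintype.card ι) {i : ι}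
    (hi : 2 ≤ (P i).length) :
    (Fintype.card ι : ℤ) - 2 ≤ transmission G ((P i).getVert 1) - transmission G x := by
  have : Nonempty ι := ⟨i⟩
  have hne : (Finset.univ.erase i).Nonempty := by
    rw [← Finset.card_pos, Finset.card_erase_of_mem (Finset.mem_univ i), Finset.card_univ]
    omega
  obtain ⟨k, hk, hmin⟩ := Finset.exists_min_image (Finset.univ.erase i) (fun i' => (P i').length) hne
  have hki : k ≠ i := Finset.ne_of_mem_erase hk
  replace hmin : ∀ i', i' ≠ i → (P k).length ≤ (P i').length := fun i' hi' =>
    hmin i' (Finset.mem_erase.2 ⟨hi', Finset.mem_univ _⟩)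
  obtain ⟨hnear, hfar⟩ := h.le_dist_snd hi hki hmin
  have hup := h.dist_start_le i k
  have hk₁ := h.one_le_length k
  set T : ι → ℤ := fun i' => ∑ j ∈ Finset.Ico 1 (P i').length,
    ((G.dist ((P i).getVert 1) ((P i').getVert j) : ℤ) - G.dist x ((P i').getVert j)) with hT
  have hfarT : ∀ i' ≠ i, ∑ j ∈ Finset.Ico 1 (P i').length,
      (min (1 + j : ℤ) (min (1 + (P k).length : ℤ) ((P i).length - 1) + (P i').length - j)
        - min (j : ℤ) (min ((P k).length : ℤ) (P i).length + (P i').length - j)) ≤ T i' :=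
    fun i' hi' => Finset.sum_le_sum fun j hj =>
      have hj' := (Finset.mem_Ico.1 hj).2.le
      sub_le_sub (hfar i' hi' j hj') (hup i' hj')
  have hTi : - min (1 + (P k).length : ℤ) ((P i).length - 1) ≤ T i := by
    rw [← sum_near hi hk₁]
    exact Finset.sum_le_sum fun j hj =>
      have hj' := (Finset.mem_Ico.1 hj).2.le
      sub_le_sub (hnear j hj') (hup i hj')
  have hTk : min ((P k).length : ℤ) (P i).length - 1 ≤ T k := by
    rw [← sum_opposite hi hk₁]
    exact hfarT k hki
  have hTo : ∀ i' ∈ (Finset.univ.erase i).erase k, 1 ≤ T i' := fun i' hi' => by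
    obtain ⟨hk', hi'⟩ := Finset.mem_erase.1 hi'
    have hi' := Finset.ne_of_mem_erase hi'
    have hle := hmin i' hi'
    refine (one_le_sum_far hi hk₁ hle ?_).trans (hfarT i' hi')
    by_contra hlt
    exact hk' (h.eq_of_length_eq_one (by omega) (by omega))
  have hx := hfar k hki 0 (by omega)
  have hy := hfar k hki _ le_rfl
  have hy' := hup k le_rfl
  rw [SimpleGraph.Walk.getVert_zero] at hx
  rw [SimpleGraph.Walk.getVert_length] at hy hy'
  have hsum : _ ≤ ∑ i' ∈ (Finset.univ.erase i).erase k, T i' := Finset.card_nsmul_le_sum _ _ _ hTo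
  rw [Finset.card_erase_of_mem hk, Finset.card_erase_of_mem (Finset.mem_univ i),
    Finset.card_univ, nsmul_eq_mul, mul_one] at hsum
  rw [transmission, transmission, ← Finset.sum_sub_distrib, h.sum_eq,
    ← Finset.add_sum_erase _ _ (Finset.mem_univ i), ← Finset.add_sum_erase _ _ hk,
    SimpleGraph.dist_self]
  change _ ≤ _ + (T i + (T k + ∑ i' ∈ (Finset.univ.erase i).erase k, T i'))
  push_cast at hx ⊢
  omega

lemma card_le_transmission_sub_end (h : IsThetaFamily P) (hι : 2 ≤ Fintype.card ι) {i : ι}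
    (hi : 2 ≤ (P i).length) : (Fintype.card ι : ℤ) - 2 ≤
      transmission G ((P i).getVert ((P i).length - 1)) - transmission G y := by
  have := h.reverse.card_le_transmission_sub hι (i := i) (by simpa using hi)
  rwa [SimpleGraph.Walk.getVert_reverse] at this

lemma le_sum_sqDiff (h : IsThetaFamily P) (hι : 2 ≤ Fintype.card ι) :
    2 * ((Fintype.card ι : ℤ) - 1) * ((Fintype.card ι : ℤ) - 2) ^ 2 ≤
      ∑ e ∈ G.edgeFinset, sqDiff G e := by
  set I : Finset ι := Finset.univ.filter fun i => 2 ≤ (P i).length with hI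
  have hmem : ∀ i ∈ I, 2 ≤ (P i).length := fun i hi => (Finset.mem_filter.1 hi).2
  have hcard : Fintype.card ι ≤ I.card + 1 := by
    have hle : Iᶜ.card ≤ 1 := Finset.card_le_one.2 fun i hi j hj => by
      simp only [hI, Finset.mem_compl, Finset.mem_filter, Finset.mem_univ, true_and] at hi hj
      have := h.one_le_length i
      have := h.one_le_length j
      exact h.eq_of_length_eq_one (by omega) (by omega)
    have := Finset.card_add_card_compl I
    omega
  set c : ℤ := (Fintype.card ι : ℤ) - 2 with hc
  have hc₀ : 0 ≤ c := by omega
  let first : ι → Sym2 V := fun i => s(x, (P i).getVert 1)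
  let last : ι → Sym2 V := fun i => s(y, (P i).getVert ((P i).length - 1))
  have hfirst : Set.InjOn first I := fun i hi j hj hij => by
    have hi := hmem i hi
    have hj := hmem j hj
    rcases h.getVert_eq_getVert (by omega) (by omega) (Sym2.congr_right.1 hij) with h' | h' | h'
    · exact h'.1
    all_goals omega
  have hlast : Set.InjOn last I := fun i hi j hj hij => by
    have hi := hmem i hi
    have hj := hmem j hj
    rcases h.getVert_eq_getVert (by omega) (by omega) (Sym2.congr_right.1 hij) with h' | h' | h'
    · exact h'.1
    all_goals omega
  have hdisj : Disjoint (I.image first) (I.image last) := by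
    refine Finset.disjoint_left.2 fun e he he' => ?_
    obtain ⟨i, hi, rfl⟩ := Finset.mem_image.1 he
    obtain ⟨j, hj, hij⟩ := Finset.mem_image.1 he'
    have hj := hmem j hj
    rcases Sym2.eq_iff.1 hij with ⟨h₁, -⟩ | ⟨-, h₂⟩
    · exact h.ne h₁.symm
    · have := (h.getVert_eq_start_iff (by omega)).1 h₂
      omega
  have hsub : I.image first ∪ I.image last ⊆ G.edgeFinset := by
    refine Finset.union_subset ?_ ?_ <;> intro e he <;>
      obtain ⟨i, hi, rfl⟩ := Finset.mem_image.1 he <;> have hi := hmem i hi <;>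
      rw [SimpleGraph.mem_edgeFinset, SimpleGraph.mem_edgeSet]
    · have := (P i).adj_getVert_succ (i := 0) (by omega)
      rwa [SimpleGraph.Walk.getVert_zero] at this
    · have := (P i).adj_getVert_succ (i := (P i).length - 1) (by omega)
      rw [Nat.sub_add_cancel (by omega), SimpleGraph.Walk.getVert_length] at this
      exact this.symm
  have hA : I.card • c ^ 2 ≤ ∑ i ∈ I, sqDiff G (first i) :=
    Finset.card_nsmul_le_sum _ _ _ fun i hi =>
      pow_le_pow_left₀ hc₀ (h.card_le_transmission_sub hι (hmem i hi)) 2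
  have hB : I.card • c ^ 2 ≤ ∑ i ∈ I, sqDiff G (last i) :=
    Finset.card_nsmul_le_sum _ _ _ fun i hi =>
      pow_le_pow_left₀ hc₀ (h.card_le_transmission_sub_end hι (hmem i hi)) 2
  have hle := Finset.sum_le_sum_of_subset_of_nonneg hsub fun e _ _ => sqDiff_nonneg (G := G) e
  rw [Finset.sum_union hdisj, Finset.sum_image hfirst, Finset.sum_image hlast] at hle
  rw [nsmul_eq_mul] at hA hB
  have hmul : ((Fintype.card ι : ℤ) - 1) * c ^ 2 ≤ I.card * c ^ 2 :=
    mul_le_mul_of_nonneg_right (by omega) (sq_nonneg c)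
  linarith

end IsThetaFamily

lemma IsTheta1.exists_isThetaFamily {V : Type*} {G : SimpleGraph V} (h : IsTheta1 G) :
    ∃ (x y : V) (P : Fin 4 → G.Walk x y), IsThetaFamily P := by
  obtain ⟨x, y, P₁, P₂, P₃, P₄, hne, p₁, p₂, p₃, p₄, -, -, -, -, n₁₂, n₁₃, n₁₄, n₂₃, n₂₄, n₃₄,
    d₁₂, d₁₃, d₁₄, d₂₃, d₂₄, d₃₄, hv, he⟩ := h
  have symm : ∀ {P Q : G.Walk x y}, IntDisj P Q → IntDisj Q P := fun hPQ v hQ hP =>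
    (hPQ v hP hQ).symm
  refine ⟨x, y, ![P₁, P₂, P₃, P₄], hne, ?_, ?_, ?_, ?_, ?_⟩
  · simp [Fin.forall_fin_succ, p₁, p₂, p₃, p₄]
  · intro i j hij
    fin_cases i <;> fin_cases j <;> simp_all
  · intro i j hij
    fin_cases i <;> fin_cases j <;>
      first | exact absurd rfl hij | assumption | (apply symm; assumption)
  · intro v
    simpa [Fin.exists_fin_succ] using hv v
  · intro e hG
    simpa [Fin.exists_fin_succ] using he e hG


/-- A Θ₁-graph of order `n ≥ 12` has revised Szeged index less than
`(n³ + 2n² − 18)/4`. -/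
theorem revSz_lt_of_isTheta1 {V : Type*} [Fintype V] (G : SimpleGraph V)
    (hΘ : IsTheta1 G) (hn : 12 ≤ Fintype.card V) :
    revSz G < ((Fintype.card V : ℚ) ^ 3 + 2 * (Fintype.card V : ℚ) ^ 2 - 18) / 4 := by
  obtain ⟨x, y, P, hP⟩ := hΘ.exists_isThetaFamily
  have hE : (G.edgeFinset.card : ℚ) ≤ Fintype.card V + 2 := by
    have := hP.card_edgeFinset_add_two_le
    rw [Fintype.card_fin] at this
    exact_mod_cast (by omega : G.edgeFinset.card ≤ Fintype.card V + 2)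
  have hS : (24 : ℚ) ≤ (∑ e ∈ G.edgeFinset, sqDiff G e : ℤ) := by
    have := hP.le_sum_sqDiff (by simp)
    rw [Fintype.card_fin] at this
    exact_mod_cast (by norm_num at this; exact this)
  rw [revSz_eq hP.connected]
  have := mul_le_mul_of_nonneg_right hE (sq_nonneg (Fintype.card V : ℚ))
  linarith
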